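/- arXiv:1912.10516 — 2 statements merged into one kernel-verified Lean document; each statement's English description precedes it below -/
import Mathlib

section
/- Let q be a prime power, v a monic irreducible polynomial in 𝔽_q[t], n an odd positive integer, and s_1, …, s_n pairwise distinct q-even integers. Then Σ_{σ ∈ S_n} sgn(σ)·ζ_v(s_{σ(1)}, …, s_{σ(n)}) = 0 in K_v, where S_n is the symmetric group on {1, …, n} and sgn(σ) ∈ {±1} is viewed in K_v via the canonical ring map from ℤ. -/
/-!
STATEMENT 0: Let q be a prime power, v a monic irreducible polynomial in 𝔽_q[t],
n an odd positive integer, and s₁, …, sₙ pairwise distinct q-even integers. Then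
Σ_{σ ∈ Sₙ} sgn(σ)·ζ_v(s_{σ(1)}, …, s_{σ(n)}) = 0 in K_v.
-/

noncomputable section

open scoped Classical

/-- The height-one prime of `F[t]` attached to an irreducible polynomial `v`. -/
def heightOneOf {F : Type*} [Field F] (v : Polynomial F) (hv : Irreducible v) :
    IsDedekindDomain.HeightOneSpectrum (Polynomial F) where
  asIdeal := Ideal.span {v}
  isPrime := (Ideal.span_singleton_prime hv.ne_zero).mpr hv.prime
  ne_bot := fun h => hv.ne_zero (Ideal.span_singleton_eq_bot.mp h)

/-- The `v`-adic completion `K_v` of `K = F(t)`. -/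
def Kv {F : Type*} [Field F] (v : Polynomial F) (hv : Irreducible v) : Type _ :=
  (heightOneOf v hv).adicCompletion (RatFunc F)

instance {F : Type*} [Field F] (v : Polynomial F) (hv : Irreducible v) : Field (Kv v hv) :=
  inferInstanceAs (Field ((heightOneOf v hv).adicCompletion (RatFunc F)))

instance {F : Type*} [Field F] (v : Polynomial F) (hv : Irreducible v) :
    UniformSpace (Kv v hv) :=
  inferInstanceAs (UniformSpace ((heightOneOf v hv).adicCompletion (RatFunc F)))

instance {F : Type*} [Field F] (v : Polynomial F) (hv : Irreducible v) :
    Algebra (RatFunc F) (Kv v hv) :=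
  inferInstanceAs (Algebra (RatFunc F) ((heightOneOf v hv).adicCompletion (RatFunc F)))

/-- `S̃_d(k) = Σ_{a monic of degree d, v ∤ a} a^{-k} ∈ F(t)`. -/
def Stilde {F : Type*} [Field F] (v : Polynomial F) (d : ℕ) (k : ℤ) : RatFunc F :=
  ∑ᶠ a ∈ {a : Polynomial F | a.Monic ∧ a.natDegree = d ∧ ¬ v ∣ a},
    (algebraMap (Polynomial F) (RatFunc F) a) ^ (-k)

/-- The general term of the series defining the `v`-adic multiple zeta value of the
tuple `w`, indexed by strictly decreasing tuples `d₁ > ⋯ > d_r ≥ 0`. -/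
def zetavTerm {F : Type*} [Field F] (v : Polynomial F) (hv : Irreducible v) (w : List ℤ)
    (d : {d : Fin w.length → ℕ // StrictAnti d}) : Kv v hv :=
  algebraMap (RatFunc F) (Kv v hv) (∏ i, Stilde v (d.1 i) (w.get i))

/-- The `v`-adic multiple zeta value `ζ_v(s₁, …, s_r) ∈ K_v`. -/
def zetav {F : Type*} [Field F] (v : Polynomial F) (hv : Irreducible v) (w : List ℤ) :
    Kv v hv :=
  ∑' d : {d : Fin w.length → ℕ // StrictAnti d}, zetavTerm v hv w d

section comb

abbrev Decr (n : ℕ) := {d : Fin n → ℕ // StrictAnti d}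

lemma summable_pi_prod {R : Type*} [CommRing R] [UniformSpace R] [IsUniformAddGroup R]
    [NonarchimedeanRing R] (m : ℕ) (f : Fin m → ℕ → R) (hf : ∀ i, Summable (f i)) :
    Summable (fun d : Fin m → ℕ => ∏ i, f i (d i)) := by
  induction m with
  | zero => exact (hasSum_fintype _).summable
  | succ m ih =>
    have h := (hf 0).mul_of_nonarchimedean (ih (fun i => f i.succ) (fun i => hf _))
    rw [← (Fin.consEquiv (fun _ : Fin (m+1) => ℕ)).summable_iff]
    refine h.congr ?_
    intro x
    simp [Fin.prod_univ_succ, Fin.consEquiv]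

/-- remove the `j`-th entry of a decreasing tuple -/
def rmv (m : ℕ) (p : Decr (m+1) × Fin (m+1)) : ℕ × Decr m :=
  (p.1.1 p.2, ⟨p.1.1 ∘ p.2.succAbove,
    p.1.2.comp_strictMono (Fin.strictMono_succAbove p.2)⟩)

lemma range_rmv (m : ℕ) (c : Fin (m+1) → ℕ) (j : Fin (m+1)) :
    Set.range c = insert (c j) (Set.range (c ∘ j.succAbove)) := by
  rw [Set.range_comp, Fin.range_succAbove, ← Set.image_insert_eq]
  rw [← Set.image_univ]
  congr 1
  ext x
  simp [em]

lemma rmv_injective (m : ℕ) : Function.Injective (rmv m) := by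
  rintro ⟨⟨c, hc⟩, j⟩ ⟨⟨c', hc'⟩, j'⟩ h
  simp only [rmv, Prod.mk.injEq, Subtype.mk.injEq] at h
  have h1 : c = c' := by
    rw [← hc.range_inj hc', range_rmv m c j, range_rmv m c' j', h.1, h.2]
  subst h1
  simpa using hc.injective h.1

lemma mem_range_rmv (m : ℕ) (e : ℕ) (d : Decr m) (he : e ∉ Set.range d.1) :
    (e, d) ∈ Set.range (rmv m) := by
  classical
  let S : Finset ℕ := insert e (Finset.univ.image d.1)
  have hS : S.card = m + 1 := by
    rw [Finset.card_insert_of_notMem (by simpa using he),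
      Finset.card_image_of_injective _ d.2.injective]
    simp
  let c : Fin (m+1) → ℕ := fun i => S.orderEmbOfFin hS i.rev
  have hc : StrictAnti c := fun i j hij => (S.orderEmbOfFin hS).strictMono (Fin.rev_lt_rev.2 hij)
  have hr : Set.range c = insert e (Set.range d.1) := by
    have : c = (S.orderEmbOfFin hS) ∘ Fin.rev := rfl
    rw [this, Fin.rev_surjective.range_comp, Finset.range_orderEmbOfFin]
    simp [S]
  obtain ⟨j, hj⟩ : e ∈ Set.range c := by rw [hr]; simp
  have hca : StrictAnti (c ∘ j.succAbove) := hc.comp_strictMono (Fin.strictMono_succAbove j)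
  refine ⟨(⟨c, hc⟩, j), ?_⟩
  simp only [rmv, hj, Prod.mk.injEq, true_and]
  apply Subtype.ext
  change c ∘ j.succAbove = d.1
  rw [← hca.range_inj d.2]
  have h2 := range_rmv m c j
  rw [hr, hj] at h2
  have h3 : e ∉ Set.range (c ∘ j.succAbove) := by
    rintro ⟨i, hi⟩
    exact Fin.succAbove_ne j i (hc.injective (hi.trans hj.symm))
  rw [← Set.insert_sdiff_self_of_notMem he, ← Set.insert_sdiff_self_of_notMem h3, h2]

lemma alt_sum_one (n : ℕ) (h : Odd n) : ∑ j : Fin n, (-1 : ℤ) ^ (j : ℕ) = 1 := by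
  rw [Fin.sum_univ_eq_sum_range (fun j => (-1 : ℤ) ^ j), neg_one_geom_sum]
  simp [Nat.not_even_iff_odd.2 h]

lemma det_cons {R : Type*} [CommRing R] (m : ℕ) (f : Fin (m+1) → ℕ → R) (c : Fin (m+1) → ℕ)
    (j : Fin (m+1)) :
    (Matrix.of fun i k => f i ((Fin.cons (c j) (c ∘ j.succAbove) : Fin (m+1) → ℕ) k)).det
      = (-1) ^ (j : ℕ) * (Matrix.of fun i k => f i (c k)).det := by
  have h : ∀ k, (Fin.cons (c j) (c ∘ j.succAbove) : Fin (m+1) → ℕ) k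
      = c (j.cycleRange.symm k) := by
    intro k
    rw [← Fin.insertNth_apply_cycleRange_symm j]
    exact congrFun (Fin.insertNth_self_removeNth j c) _
  simp_rw [h]
  have := Matrix.det_permute' (j.cycleRange.symm) (Matrix.of fun i k => f i (c k))
  rw [Equiv.Perm.sign_symm, Fin.sign_cycleRange] at this
  have h2 : (Matrix.of fun i k => f i (c (j.cycleRange.symm k)))
    = (Matrix.of fun i k => f i (c k)).submatrix id j.cycleRange.symm := rfl
  rw [h2, this]
  simp

theorem comb_main {R : Type*} [CommRing R] [UniformSpace R] [IsUniformAddGroup R]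
    [NonarchimedeanRing R] [T2Space R] [CompleteSpace R] (n : ℕ) (hodd : Odd n) (f : Fin n → ℕ → R)
    (hf : ∀ i, HasSum (f i) 0) :
    ∑ σ : Equiv.Perm (Fin n), (Equiv.Perm.sign σ : ℤ) •
      ∑' d : Decr n, ∏ i, f (σ i) (d.1 i) = 0 := by
  obtain ⟨m, rfl⟩ : ∃ m, n = m + 1 := ⟨n - 1, by have := hodd.pos; omega⟩
  have hr : ∀ (k : ℕ) (g : Fin k → Fin (m+1)),
      Summable (fun d : Decr k => ∏ i, f (g i) (d.1 i)) := by
    intro k g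
    exact (summable_pi_prod k (fun i => f (g i)) (fun i => (hf _).summable)).comp_injective
      Subtype.coe_injective
  have hs : ∀ σ : Equiv.Perm (Fin (m+1)), Summable (fun d : Decr (m+1) => ∏ i, f (σ i) (d.1 i)) := by
    intro σ
    exact hr (m+1) σ
  have hG : HasSum (fun p : ℕ × Decr m =>
      (Matrix.of fun i k => f i ((Fin.cons p.1 p.2.1 : Fin (m+1) → ℕ) k)).det) 0 := by
    simp only [Matrix.det_apply]
    have : (0 : R) = ∑ σ : Equiv.Perm (Fin (m+1)), 0 := by simp
    rw [this]
    apply hasSum_sum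
    intro σ _
    have h1 : Summable (fun d : Decr m => ∏ i : Fin m, f (σ i.succ) (d.1 i)) :=
      hr m (fun i => σ i.succ)
    have h2 := ((hf (σ 0)).mul_of_nonarchimedean h1.hasSum).const_smul
      ((Equiv.Perm.sign σ : ℤ))
    rw [zero_mul, smul_zero] at h2
    refine h2.congr_fun ?_
    intro p
    simp [Fin.prod_univ_succ, Units.smul_def]
  have hD : HasSum (fun c : Decr (m+1) => (Matrix.of fun i k => f i (c.1 k)).det) 0 := by
    rw [← (rmv_injective m).hasSum_iff] at hG
    · refine hG.prod_fiberwise fun c => ?_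
      have h3 := hasSum_fintype (fun j : Fin (m+1) =>
        (-1 : R) ^ (j : ℕ) * (Matrix.of fun i k => f i (c.1 k)).det)
      have h4 : ∑ j : Fin (m+1), (-1 : R) ^ (j : ℕ) = 1 := by
        simpa using congrArg (Int.cast : ℤ → R) (alt_sum_one (m+1) hodd)
      rw [← Finset.sum_mul, h4, one_mul] at h3
      convert h3 using 2 with j
      exact det_cons m f c.1 j
    · rintro ⟨e, d⟩ hp
      have he : e ∈ Set.range d.1 := by
        by_contra he
        exact hp (mem_range_rmv m e d he)
      obtain ⟨i, hi⟩ := he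
      refine Matrix.det_zero_of_column_eq (i := 0) (j := i.succ) (Fin.succ_ne_zero i).symm ?_
      intro k
      simp [hi]
  rw [← hD.tsum_eq]
  simp only [Matrix.det_apply]
  rw [Summable.tsum_finsetSum]
  · refine Finset.sum_congr rfl fun σ _ => ?_
    rw [← (hs σ).tsum_const_smul]
    simp [Units.smul_def]
  · intro σ _
    exact (hs σ).const_smul (Equiv.Perm.sign σ : ℤ)
end comb

section alg
open Polynomial

lemma finite_degLT {F : Type*} [Field F] [Fintype F] (M : ℕ) :
    {a : F[X] | a.degree < M}.Finite := by
  have : Finite (degreeLT F M) := Finite.of_equiv _ (degreeLTEquiv F M).toEquiv.symm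
  have h : {a : F[X] | a.degree < M} = (degreeLT F M : Set F[X]) := by
    ext a; simp [mem_degreeLT]
  rw [h]; exact Set.toFinite _

/-- the summand, extended by zero to multiples of `v` -/
def gfun {F : Type*} [Field F] (v : F[X]) (k : ℤ) (a : F[X]) : RatFunc F :=
  if v ∣ a then 0 else (algebraMap F[X] (RatFunc F) a) ^ (-k)

lemma val_one {F : Type*} [Field F] (v : F[X]) (hv : Irreducible v) (a : F[X]) (h : ¬ v ∣ a) :
    (heightOneOf v hv).valuation (RatFunc F) (algebraMap F[X] (RatFunc F) a) = 1 := by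
  rw [IsDedekindDomain.HeightOneSpectrum.valuation_eq_one_iff_notMem]
  simpa [heightOneOf, Ideal.mem_span_singleton] using h

lemma val_le {F : Type*} [Field F] (v : F[X]) (hv : Irreducible v) (N : ℕ) (a : F[X])
    (h : v ^ N ∣ a) :
    (heightOneOf v hv).valuation (RatFunc F) (algebraMap F[X] (RatFunc F) a) ≤
      (heightOneOf v hv).valuation (RatFunc F) (algebraMap F[X] (RatFunc F) v) ^ N := by
  obtain ⟨b, rfl⟩ := h
  rw [map_mul, map_mul, map_pow, map_pow]
  exact mul_le_of_le_one_right' (IsDedekindDomain.HeightOneSpectrum.valuation_le_one _ b)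

lemma val_zpow_sub {F : Type*} [Field F] (v : F[X]) (hv : Irreducible v) (N : ℕ) (a b : F[X])
    (h : v ^ N ∣ a - b) (ha : ¬ v ∣ a) (hb : ¬ v ∣ b) (k : ℤ) :
    (heightOneOf v hv).valuation (RatFunc F)
      ((algebraMap F[X] (RatFunc F) a) ^ k - (algebraMap F[X] (RatFunc F) b) ^ k) ≤
      (heightOneOf v hv).valuation (RatFunc F) (algebraMap F[X] (RatFunc F) v) ^ N := by
  have key : ∀ k : ℕ, (heightOneOf v hv).valuation (RatFunc F)
      ((algebraMap F[X] (RatFunc F) a) ^ k - (algebraMap F[X] (RatFunc F) b) ^ k) ≤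
      (heightOneOf v hv).valuation (RatFunc F) (algebraMap F[X] (RatFunc F) v) ^ N := by
    intro k
    rw [← map_pow, ← map_pow, ← map_sub]
    exact val_le v hv N _ (h.trans (sub_dvd_pow_sub_pow a b k))
  have va := val_one v hv a ha
  have vb := val_one v hv b hb
  obtain ⟨k, rfl | rfl⟩ := k.eq_nat_or_neg
  · simpa using key k
  · have ha0 : algebraMap F[X] (RatFunc F) a ≠ 0 := by
      intro h0; rw [h0] at va; simp at va
    have hb0 : algebraMap F[X] (RatFunc F) b ≠ 0 := by
      intro h0; rw [h0] at vb; simp at vb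
    have e : (algebraMap F[X] (RatFunc F) a) ^ (-(k : ℤ)) - (algebraMap F[X] (RatFunc F) b) ^ (-(k : ℤ))
      = ((algebraMap F[X] (RatFunc F) b) ^ k - (algebraMap F[X] (RatFunc F) a) ^ k) *
        ((algebraMap F[X] (RatFunc F) a) ^ k * (algebraMap F[X] (RatFunc F) b) ^ k)⁻¹ := by
      simp only [zpow_neg, zpow_natCast]
      field_simp
    rw [e, map_mul, map_inv₀, map_mul, map_pow, map_pow, va, vb, Valuation.map_sub_swap]
    simpa using key k

lemma val_full_sum {F : Type*} [Field F] [Fintype F] (v : F[X]) (hm : v.Monic)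
    (hv : Irreducible v) (k : ℤ) (N M : ℕ) (hN : N ≠ 0) (hM : N * v.natDegree < M) :
    (heightOneOf v hv).valuation (RatFunc F) (∑ a ∈ (finite_degLT (F := F) M).toFinset, gfun v k a) ≤
      (heightOneOf v hv).valuation (RatFunc F) (algebraMap F[X] (RatFunc F) v) ^ N := by
  classical
  have hdeg : (v ^ N).natDegree = N * v.natDegree := hm.natDegree_pow N
  set K := N * v.natDegree with hK
  have hco : (v ^ N).coeff K = 1 := by
    rw [← hdeg]; exact (hm.pow N).coeff_natDegree
  have hlt : ∀ c : F, (C c * v ^ N).degree < M := by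
    intro c
    refine lt_of_le_of_lt (degree_le_natDegree) ?_
    refine lt_of_le_of_lt ?_ (Nat.cast_lt.2 hM)
    refine Nat.cast_le.2 ((natDegree_C_mul_le _ _).trans hdeg.le)
  have e : ∑ a ∈ (finite_degLT (F := F) M).toFinset, gfun v k a
      = ∑ p ∈ ((finite_degLT (F := F) M).toFinset.filter (fun a => a.coeff K = 0)) ×ˢ
        (Finset.univ : Finset F), gfun v k (p.1 + C p.2 * v ^ N) := by
    refine Finset.sum_nbij' (fun a => (a - C (a.coeff K) * v ^ N, a.coeff K))
      (fun p => p.1 + C p.2 * v ^ N) ?_ ?_ ?_ ?_ ?_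
    · intro a ha
      simp only [Set.Finite.mem_toFinset, Set.mem_ofPred_eq] at ha
      simp only [Finset.mem_product, Finset.mem_filter, Set.Finite.mem_toFinset, Set.mem_ofPred_eq,
        Finset.mem_univ, and_true]
      refine ⟨lt_of_le_of_lt (degree_sub_le _ _) (max_lt ha (hlt _)), ?_⟩
      simp [hco]
    · rintro ⟨b, c⟩ hb
      simp only [Finset.mem_product, Finset.mem_filter, Set.Finite.mem_toFinset, Set.mem_ofPred_eq,
        Finset.mem_univ, and_true] at hb ⊢
      exact lt_of_le_of_lt (degree_add_le _ _) (max_lt hb.1 (hlt _))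
    · intro a _; simp
    · rintro ⟨b, c⟩ hb
      simp only [Finset.mem_product, Finset.mem_filter, Set.Finite.mem_toFinset, Set.mem_ofPred_eq,
        Finset.mem_univ, and_true] at hb
      simp [hco, hb.2]
    · intro a _; simp
  rw [e, Finset.sum_product]
  refine Valuation.map_sum_le _ fun b _ => ?_
  have hd : ∀ c : F, v ∣ C c * v ^ N := fun c => (dvd_pow_self v hN).mul_left _
  by_cases hb : v ∣ b
  · have : ∀ c : F, gfun v k (b + C c * v ^ N) = 0 := by
      intro c
      simp [gfun, dvd_add hb (hd c)]
    simp [this]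
  · have h1 : ∀ c : F, ¬ v ∣ b + C c * v ^ N := fun c h => hb ((dvd_add_left (hd c)).1 h)
    have h2 : ∑ c : F, gfun v k (b + C c * v ^ N) = ∑ c : F,
       ((algebraMap F[X] (RatFunc F) (b + C c * v ^ N)) ^ (-k)
        - (algebraMap F[X] (RatFunc F) b) ^ (-k)) := by
      rw [Finset.sum_sub_distrib]
      have : (Fintype.card F : RatFunc F) = 0 := by
        rw [← map_natCast (algebraMap F (RatFunc F)), Nat.cast_card_eq_zero, map_zero]
      simp [gfun, h1, this]
    rw [h2]
    refine Valuation.map_sum_le _ fun c _ => ?_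
    exact val_zpow_sub v hv N _ _ (by simp) (h1 c) hb _

lemma partial_sum {F : Type*} [Field F] [Fintype F] (v : F[X]) 
    (k : ℤ) (hk : ((Fintype.card F : ℤ) - 1) ∣ k) (M : ℕ) :
    ∑ d ∈ Finset.range M, Stilde v d k
      = - ∑ a ∈ (finite_degLT (F := F) M).toFinset, gfun v k a := by
  classical
  set P := (finite_degLT (F := F) M).toFinset with hP
  have hmP : ∀ a, a ∈ P ↔ a.degree < M := by intro a; simp [hP]
  have h1 : ∑ d ∈ Finset.range M, Stilde v d k = ∑ a ∈ P.filter (fun a => a.Monic), gfun v k a := by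
    have : ∀ d ∈ Finset.range M, Stilde v d k =
      ∑ a ∈ (P.filter (fun a => a.Monic)).filter (fun a => a.natDegree = d), gfun v k a := by
      intro d hd
      rw [Finset.mem_range] at hd
      unfold Stilde
      rw [← Finset.sum_filter_add_sum_filter_not _ (fun a => ¬ v ∣ a)]
      rw [Finset.sum_eq_zero (s := Finset.filter (fun a => ¬ ¬ v ∣ a) _), add_zero]
      · have hset : {a : F[X] | a.Monic ∧ a.natDegree = d ∧ ¬ v ∣ a} =
            ((((P.filter (fun a => a.Monic)).filter (fun a => a.natDegree = d)).filter
              (fun a => ¬ v ∣ a) : Finset F[X]) : Set F[X]) := by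
          ext a
          simp only [Set.mem_ofPred_eq, Finset.coe_filter, Finset.mem_filter, hmP]
          constructor
          · rintro ⟨h1, h2, h3⟩
            exact ⟨⟨⟨(natDegree_lt_iff_degree_lt h1.ne_zero).1 (h2 ▸ hd), h1⟩, h2⟩, h3⟩
          · rintro ⟨⟨⟨_, h1⟩, h2⟩, h3⟩
            exact ⟨h1, h2, h3⟩
        rw [hset, finsum_mem_coe_finset]
        refine Finset.sum_congr rfl fun a ha => ?_
        simp [gfun, (Finset.mem_filter.1 ha).2]
      · intro a ha
        simp only [Finset.mem_filter, not_not] at ha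
        simp [gfun, ha.2]
    rw [Finset.sum_congr rfl this]
    refine Finset.sum_fiberwise_of_maps_to ?_ _
    intro a ha
    rw [Finset.mem_filter, hmP] at ha
    rw [Finset.mem_range]
    exact (natDegree_lt_iff_degree_lt ha.2.ne_zero).2 ha.1
  have hu : ∀ (u : Fˣ) (a : F[X]), gfun v k (C (u : F) * a) = gfun v k a := by
    intro u a
    have hdvd : v ∣ C (u : F) * a ↔ v ∣ a :=
      (isUnit_C.2 u.isUnit).dvd_mul_left
    unfold gfun
    simp only [hdvd]
    split_ifs with h
    · rfl
    · rw [map_mul, mul_zpow]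
      have hone : (u : F) ^ (-k) = 1 := by
        obtain ⟨m, rfl⟩ := hk
        have : (u : F) ^ ((Fintype.card F : ℤ) - 1) = 1 := by
          have h1 : 1 ≤ Fintype.card F := Fintype.card_pos
          have h2 : ((Fintype.card F : ℤ) - 1) = ((Fintype.card F - 1 : ℕ) : ℤ) := by
            push_cast [h1]; rfl
          rw [h2, zpow_natCast]
          exact FiniteField.pow_card_sub_one_eq_one _ u.ne_zero
        rw [← mul_neg, zpow_mul, this, one_zpow]
      have h3 : algebraMap F[X] (RatFunc F) (C (u : F)) = algebraMap F (RatFunc F) u := rfl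
      rw [h3, ← map_zpow₀, hone, map_one, one_mul]
  have h2 : ∑ a ∈ P, gfun v k a = ∑ p ∈ (Finset.univ : Finset Fˣ) ×ˢ P.filter (fun a => a.Monic),
      gfun v k p.2 := by
    have hz : ∑ a ∈ P, gfun v k a = ∑ a ∈ P.filter (fun a => a ≠ 0), gfun v k a := by
      refine (Finset.sum_filter_of_ne ?_).symm
      intro a _ h h0
      subst h0
      simp [gfun] at h
    rw [hz]
    symm
    refine Finset.sum_bij (fun p _ => C (p.1 : F) * p.2) ?_ ?_ ?_ ?_
    · rintro ⟨u, a⟩ hp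
      simp only [Finset.mem_product, Finset.mem_filter, hmP, Finset.mem_univ, true_and] at hp ⊢
      rw [degree_C_mul u.ne_zero]
      exact ⟨hp.1, mul_ne_zero (by simp) hp.2.ne_zero⟩
    · rintro ⟨u, a⟩ hp ⟨u', a'⟩ hp' h
      simp only [Finset.mem_product, Finset.mem_filter, hmP, Finset.mem_univ, true_and] at hp hp'
      have hl := congrArg leadingCoeff h
      simp only [leadingCoeff_mul, leadingCoeff_C, hp.2.leadingCoeff, hp'.2.leadingCoeff,
        mul_one] at hl
      have huu : u = u' := Units.ext hl
      subst huu
      simp only [Prod.mk.injEq, true_and]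
      exact mul_left_cancel₀ (by simp) h
    · intro a ha
      simp only [Finset.mem_filter, hmP] at ha
      have hl : a.leadingCoeff ≠ 0 := leadingCoeff_ne_zero.2 ha.2
      refine ⟨(Units.mk0 _ hl, C a.leadingCoeff⁻¹ * a), ?_, ?_⟩
      · simp only [Finset.mem_product, Finset.mem_filter, hmP, Finset.mem_univ, true_and]
        refine ⟨by rw [degree_C_mul (inv_ne_zero hl)]; exact ha.1, ?_⟩
        simp [Monic, hl]
      · simp only [Units.val_mk0]
        rw [← mul_assoc, ← C_mul, mul_inv_cancel₀ hl, C_1, one_mul]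
    · rintro ⟨u, a⟩ _
      exact (hu u a).symm
  rw [h1, h2, Finset.sum_product]
  have h0 : (Fintype.card F : RatFunc F) = 0 := by
    rw [← map_natCast (algebraMap F (RatFunc F)), Nat.cast_card_eq_zero, map_zero]
  have : ((Fintype.card Fˣ : ℕ) : RatFunc F) = -1 := by
    rw [Fintype.card_units, Nat.cast_sub Fintype.card_pos, h0]
    simp
  simp only [Finset.sum_const, Finset.card_univ, nsmul_eq_mul, this]
  simp

end alg

section top

instance instUAG {F : Type*} [Field F] (v : Polynomial F) (hv : Irreducible v) :
    IsUniformAddGroup (Kv v hv) :=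
  inferInstanceAs (IsUniformAddGroup ((heightOneOf v hv).adicCompletion (RatFunc F)))

instance instCS {F : Type*} [Field F] (v : Polynomial F) (hv : Irreducible v) :
    CompleteSpace (Kv v hv) :=
  inferInstanceAs (CompleteSpace ((heightOneOf v hv).adicCompletion (RatFunc F)))

instance instT2 {F : Type*} [Field F] (v : Polynomial F) (hv : Irreducible v) :
    T2Space (Kv v hv) :=
  inferInstanceAs (T2Space ((heightOneOf v hv).adicCompletion (RatFunc F)))

lemma valued_nonarch {R Γ₀ : Type*} [Ring R] [LinearOrderedCommGroupWithZero Γ₀] [Valued R Γ₀] :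
    NonarchimedeanRing R where
  is_nonarchimedean := by
    intro U hU
    obtain ⟨γ, hγ⟩ := Valued.mem_nhds_zero.1 hU
    let H : AddSubgroup R := (Valued.v (R := R)).restrict.ltAddSubgroup γ
    have hH : (H : Set R) = {x | Valued.v.restrict x < γ.1} := rfl
    refine ⟨⟨H, ?_⟩, hγ⟩
    apply AddSubgroup.isOpen_of_mem_nhds H (g := 0)
    rw [Valued.mem_nhds_zero]
    exact ⟨γ, le_rfl⟩

instance instNA {F : Type*} [Field F] (v : Polynomial F) (hv : Irreducible v) :
    NonarchimedeanRing (Kv v hv) :=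
  (valued_nonarch : NonarchimedeanRing ((heightOneOf v hv).adicCompletion (RatFunc F)))

lemma tendsto_of_val {F : Type*} [Field F] (v : Polynomial F) (hv : Irreducible v)
    (u : ℕ → RatFunc F)
    (h : ∀ N : ℕ, N ≠ 0 → ∀ᶠ M in Filter.atTop, (heightOneOf v hv).valuation (RatFunc F) (u M) ≤
      (heightOneOf v hv).valuation (RatFunc F) (algebraMap _ (RatFunc F) v) ^ N) :
    Filter.Tendsto (fun M => algebraMap (RatFunc F) (Kv v hv) (u M)) Filter.atTop (nhds 0) := by
  change Filter.Tendsto (fun M => algebraMap (RatFunc F)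
    ((heightOneOf v hv).adicCompletion (RatFunc F)) (u M)) Filter.atTop (nhds 0)
  rw [(Valued.hasBasis_nhds_zero _ _).tendsto_right_iff]
  intro y _
  have hlt : (heightOneOf v hv).valuation (RatFunc F) (algebraMap _ (RatFunc F) v) < 1 := by
    rw [IsDedekindDomain.HeightOneSpectrum.valuation_lt_one_iff_mem]
    exact Ideal.mem_span_singleton_self v
  obtain ⟨n, hn⟩ := exists_pow_lt₀ hlt
    (Units.map (MonoidWithZeroHom.ValueGroup₀.embedding (f := (.ofClass (Valued.v 
      (R := (heightOneOf v hv).adicCompletion (RatFunc F)))))) y)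
  filter_upwards [h (n+1) (by simp)] with M hM
  rw [Valuation.restrict_lt_iff_lt_embedding]
  refine lt_of_le_of_lt ?_ hn
  have : Valued.v (algebraMap (RatFunc F) ((heightOneOf v hv).adicCompletion (RatFunc F)) (u M)) =
    (heightOneOf v hv).valuation (RatFunc F) (u M) :=
    IsDedekindDomain.HeightOneSpectrum.valuedAdicCompletion_eq_valuation' _ _
  rw [this]
  exact hM.trans (pow_le_pow_right_of_le_one' hlt.le (Nat.le_succ n))

end top

lemma hasSum_Stilde {F : Type*} [Field F] [Fintype F] (v : Polynomial F) (hm : v.Monic)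
    (hv : Irreducible v) (k : ℤ) (hk : ((Fintype.card F : ℤ) - 1) ∣ k) :
    HasSum (fun d : ℕ => algebraMap (RatFunc F) (Kv v hv) (Stilde v d k)) 0 := by
  have hZ : Filter.Tendsto (fun M => ∑ d ∈ Finset.range M,
      algebraMap (RatFunc F) (Kv v hv) (Stilde v d k)) Filter.atTop (nhds 0) := by
    simp_rw [← map_sum]
    apply tendsto_of_val
    intro N hN
    filter_upwards [Filter.eventually_gt_atTop (N * v.natDegree)] with M hM
    rw [partial_sum v k hk, Valuation.map_neg]
    exact val_full_sum v hm hv k N M hN hM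
  have ht : Filter.Tendsto (fun d : ℕ => algebraMap (RatFunc F) (Kv v hv) (Stilde v d k))
      Filter.atTop (nhds 0) := by
    have h1 := (hZ.comp (Filter.tendsto_add_atTop_nat 1)).sub hZ
    rw [sub_zero] at h1
    refine h1.congr fun d => ?_
    simp [Finset.sum_range_succ]
  have hs : Summable (fun d : ℕ => algebraMap (RatFunc F) (Kv v hv) (Stilde v d k)) := by
    apply NonarchimedeanAddGroup.summable_of_tendsto_cofinite_zero
    rwa [Nat.cofinite_eq_atTop]
  have := tendsto_nhds_unique hs.hasSum.tendsto_sum_nat hZ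
  rw [← this]
  exact hs.hasSum

lemma zetav_cast {F : Type*} [Field F] (v : Polynomial F) (hv : Irreducible v) (w : List ℤ)
    (n : ℕ) (h : w.length = n) :
    zetav v hv w = ∑' d : Decr n, ∏ i : Fin n,
      algebraMap (RatFunc F) (Kv v hv) (Stilde v (d.1 i) (w.get (Fin.cast h.symm i))) := by
  subst h
  unfold zetav zetavTerm
  simp only [map_prod]
  rfl

theorem statement0 {F : Type*} [Field F] [Fintype F] (q : ℕ) (hq : Fintype.card F = q)
    (v : Polynomial F) (hvmonic : v.Monic) (hv : Irreducible v)
    (n : ℕ) (hodd : Odd n) (hpos : 0 < n)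
    (s : Fin n → ℤ) (hinj : Function.Injective s)
    (heven : ∀ i, ((q : ℤ) - 1) ∣ s i)
    (hsum : ∀ σ : Equiv.Perm (Fin n), Summable (zetavTerm v hv (List.ofFn (s ∘ σ)))) :
    ∑ σ : Equiv.Perm (Fin n),
      (Equiv.Perm.sign σ : ℤ) • zetav v hv (List.ofFn (s ∘ σ)) = 0 := by
  subst hq
  have h := comb_main (R := Kv v hv) n hodd
    (fun i d => algebraMap (RatFunc F) (Kv v hv) (Stilde v d (s i)))
    (fun i => hasSum_Stilde v hvmonic hv (s i) (heven i))
  rw [← h]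
  refine Finset.sum_congr rfl fun σ _ => ?_
  rw [zetav_cast v hv _ n (List.length_ofFn)]
  simp

end
end

section
/- Let q be a power of 2, v a monic irreducible polynomial in 𝔽_q[t], n ≥ 1, and let s_1, …, s_n be integers with multiplicities k_1, …, k_n ≥ 1 and φ = k_1 + ⋯ + k_n. Assume that the integers s_1, …, s_n, together with 2s_i for each i with k_i > 1, are pairwise distinct and all q-even. Then Σ_{i : k_i > 1} Σ_{σ ∈ L(s_i*)} ζ_v^⋆(σ) + φ · Σ_{σ ∈ L(s_0)} ζ_v^⋆(σ) = 0 in K_v, where φ·x denotes the φ-fold sum of x. -/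
/-!
STATEMENT 6: Let q be a power of 2, v a monic irreducible polynomial in 𝔽_q[t], n ≥ 1, and
let s₁, …, sₙ be integers with multiplicities k₁, …, kₙ ≥ 1 and φ = k₁ + ⋯ + kₙ. Assume that
the integers s₁, …, sₙ together with 2sᵢ for each i with kᵢ > 1 are pairwise distinct and all
q-even.  Then Σ_{i : kᵢ > 1} Σ_{σ ∈ L(sᵢ*)} ζ_v^⋆(σ) + φ · Σ_{σ ∈ L(s₀)} ζ_v^⋆(σ) = 0 in K_v.
-/

noncomputable section

open scoped Classical

/-- The general term of the series defining the `v`-adic multiple zeta value of the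
tuple `w`, indexed by weakly decreasing tuples `d₁ ≥ ⋯ ≥ d_r ≥ 0`. -/
def zetavStarTerm {F : Type*} [Field F] (v : Polynomial F) (hv : Irreducible v) (w : List ℤ)
    (d : {d : Fin w.length → ℕ // Antitone d}) : Kv v hv :=
  algebraMap (RatFunc F) (Kv v hv) (∏ i, Stilde v (d.1 i) (w.get i))

/-- The `v`-adic multiple zeta star value `ζ_v^⋆(s₁, …, s_r) ∈ K_v`. -/
def zetavStar {F : Type*} [Field F] (v : Polynomial F) (hv : Irreducible v) (w : List ℤ) :
    Kv v hv :=
  ∑' d : {d : Fin w.length → ℕ // Antitone d}, zetavStarTerm v hv w d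

/-- The tuple consisting of `c 1` copies of `s 1`, followed by `c 2` copies of `s 2`, …,
followed by `c n` copies of `s n`. -/
def mkTuple {S : Type*} {n : ℕ} (s : Fin n → S) (c : Fin n → ℕ) : List S :=
  (List.finRange n).flatMap fun j => List.replicate (c j) (s j)

/-- The sum of `f` over all distinct orderings (multiset permutations) of the tuple `u`,
each counted once. -/
def Lsum {α β : Type*} [AddCommMonoid β] (f : List α → β) (u : List α) : β :=
  ∑ᶠ w ∈ {w : List α | List.Perm w u}, f w


theorem Lsum_congr_perm {α β : Type*} [AddCommMonoid β] (f : List α → β) {u u' : List α}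
    (h : u.Perm u') : Lsum f u = Lsum f u' := by
  unfold Lsum
  have : {w : List α | List.Perm w u} = {w : List α | List.Perm w u'} := by
    ext w
    exact ⟨fun h1 => h1.trans h, fun h1 => h1.trans h.symm⟩
  rw [this]

theorem finite_perms {α : Type*} (u : List α) : {w : List α | List.Perm w u}.Finite := by
  refine (List.finite_toSet u.permutations).subset ?_
  intro w hw
  exact List.mem_permutations.2 hw

theorem Lsum_nil {α β : Type*} [AddCommMonoid β] (f : List α → β) : Lsum f [] = f [] := by
  simp [Lsum]

theorem Lsum_rec {β : Type*} [AddCommMonoid β] (f : List ℤ → β) (u : List ℤ) (hu : u ≠ []) :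
    Lsum f u = ∑ a ∈ u.toFinset, Lsum (fun w => f (a :: w)) (u.erase a) := by
  have h1 : {w : List ℤ | List.Perm w u} =
      ⋃ a ∈ (u.toFinset : Set ℤ), (fun w => a :: w) '' {w : List ℤ | List.Perm w (u.erase a)} := by
    ext w
    cases w with
    | nil => simpa using hu
    | cons b w =>
      simp [List.cons_perm_iff_perm_erase, and_comm]
  unfold Lsum
  rw [h1, finsum_mem_biUnion]
  · rw [finsum_mem_coe_finset]
    refine Finset.sum_congr rfl fun a _ => ?_
    rw [finsum_mem_image]
    intro x _ y _ hxy
    simpa using hxy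
  · intro a _ b _ hab
    rw [Function.onFun, Set.disjoint_left]
    rintro w ⟨x, _, rfl⟩ ⟨y, _, hy⟩
    simp at hy
    exact hab hy.1.symm
  · exact Finset.finite_toSet _
  · intro a _
    exact (finite_perms _).image _

theorem Lsum_add {α β : Type*} [AddCommMonoid β] (f g : List α → β) (u : List α) :
    Lsum (fun w => f w + g w) u = Lsum f u + Lsum g u :=
  finsum_mem_add_distrib (finite_perms u)

theorem Lsum_mul {α β : Type*} [Semiring β] (f : List α → β) (c : β) (u : List α) :
    Lsum (fun w => c * f w) u = c * Lsum f u :=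
  ((AddMonoidHom.mulLeft c).map_finsum_mem f (finite_perms u)).symm

/-- Truncated star sum, degrees `< D`. -/
def WW {R : Type*} [CommRing R] (e : ℕ → ℤ → R) : ℕ → List ℤ → R
  | _, [] => 1
  | 0, _ :: _ => 0
  | D + 1, a :: w => WW e D (a :: w) + e D a * WW e (D + 1) w
termination_by D w => (w.length, D)

theorem WW_nil {R : Type*} [CommRing R] (e : ℕ → ℤ → R) (D : ℕ) : WW e D [] = 1 := by
  rw [WW]

theorem Lsum_WW_zero {R : Type*} [CommRing R] (e : ℕ → ℤ → R) (u : List ℤ) (hu : u ≠ []) :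
    Lsum (WW e 0) u = 0 := by
  rw [Lsum_rec _ _ hu]
  refine Finset.sum_eq_zero fun a _ => ?_
  have : (fun w => WW e 0 (a :: w)) = fun _ => 0 := by
    funext w
    rw [WW]
  rw [this]
  simp [Lsum]

theorem Lsum_WW_succ {R : Type*} [CommRing R] (e : ℕ → ℤ → R) (D : ℕ) (u : List ℤ) :
    Lsum (WW e (D + 1)) u = Lsum (WW e D) u
      + ∑ a ∈ u.toFinset, e D a * Lsum (WW e (D + 1)) (u.erase a) := by
  by_cases hu : u = []
  · subst hu
    simp [Lsum_nil, WW_nil]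
  · rw [Lsum_rec _ _ hu, Lsum_rec (WW e D) _ hu, ← Finset.sum_add_distrib]
    refine Finset.sum_congr rfl fun a _ => ?_
    rw [← Lsum_mul, ← Lsum_add]
    congr 1
    funext w
    rw [WW]

theorem count_mkTuple {n : ℕ} (s : Fin n → ℤ) (c : Fin n → ℕ) (a : ℤ) :
    (mkTuple s c).count a = ∑ j, if s j = a then c j else 0 := by
  unfold mkTuple
  rw [List.count_flatMap, ← List.sum_ofFn, List.ofFn_eq_map]
  congr 1
  apply List.map_congr_left
  intro j _
  simp [List.count_replicate]

theorem count_mkTuple_self {n : ℕ} (s : Fin n → ℤ) (hs : Function.Injective s)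
    (c : Fin n → ℕ) (i : Fin n) : (mkTuple s c).count (s i) = c i := by
  rw [count_mkTuple]
  simp [hs.eq_iff]

theorem mem_mkTuple {n : ℕ} (s : Fin n → ℤ)
    (c : Fin n → ℕ) (a : ℤ) : a ∈ mkTuple s c ↔ ∃ i, c i ≠ 0 ∧ a = s i := by
  simp [mkTuple, List.mem_replicate]

theorem mkTuple_erase {n : ℕ} (s : Fin n → ℤ) (hs : Function.Injective s)
    (c : Fin n →₀ ℕ) (i : Fin n) :
    ((mkTuple s c).erase (s i)).Perm (mkTuple s (c - Finsupp.single i 1 : Fin n →₀ ℕ)) := by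
  rw [List.perm_iff_count]
  intro a
  by_cases ha : ∃ j, a = s j
  · obtain ⟨j, rfl⟩ := ha
    rw [List.count_erase, count_mkTuple_self s hs, count_mkTuple_self s hs]
    by_cases hij : i = j
    · subst hij; simp
    · have : s i ≠ s j := fun h => hij (hs h)
      simp [Finsupp.single_apply, hij, this]
  · push Not at ha
    rw [List.count_eq_zero_of_not_mem, List.count_eq_zero_of_not_mem]
    · rw [mem_mkTuple]; rintro ⟨j, _, h⟩; exact ha j h
    · intro h
      have h := List.mem_of_mem_erase h
      rw [mem_mkTuple] at h; obtain ⟨j, _, h⟩ := h; exact ha j h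

theorem toFinset_mkTuple {n : ℕ} (s : Fin n → ℤ) (c : Fin n → ℕ) :
    (mkTuple s c).toFinset = (Finset.univ.filter fun i => c i ≠ 0).image s := by
  ext a
  simp only [List.mem_toFinset, mem_mkTuple, Finset.mem_image, Finset.mem_filter,
    Finset.mem_univ, true_and]
  exact ⟨fun ⟨i, h, hh⟩ => ⟨i, h, hh.symm⟩, fun ⟨i, h, hh⟩ => ⟨i, h, hh.symm⟩⟩

/-- Recursion for tuples. -/
theorem zrec {R : Type*} [CommRing R] (e : ℕ → ℤ → R) {n : ℕ} (s : Fin n → ℤ)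
    (hs : Function.Injective s) (D : ℕ) (c : Fin n →₀ ℕ) :
    Lsum (WW e (D + 1)) (mkTuple s c) = Lsum (WW e D) (mkTuple s c)
      + ∑ i, if c i ≠ 0 then e D (s i) *
          Lsum (WW e (D + 1)) (mkTuple s (c - Finsupp.single i 1 : Fin n →₀ ℕ)) else 0 := by
  rw [Lsum_WW_succ, toFinset_mkTuple, Finset.sum_image (fun x _ y _ h => hs h), Finset.sum_filter]
  congr 1
  refine Finset.sum_congr rfl fun i _ => ?_
  rw [Lsum_congr_perm _ (mkTuple_erase s hs c i)]

theorem grec {R : Type*} [CommRing R] (e : ℕ → ℤ → R) {n : ℕ} (s : Fin n → ℤ)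
    (hs : Function.Injective s) (b : ℤ) (hb : ∀ j, b ≠ s j) (D : ℕ) (c : Fin n →₀ ℕ) :
    Lsum (WW e (D + 1)) (b :: mkTuple s c) = Lsum (WW e D) (b :: mkTuple s c)
      + (e D b * Lsum (WW e (D + 1)) (mkTuple s c) + ∑ i, if c i ≠ 0 then e D (s i) *
          Lsum (WW e (D + 1)) (b :: mkTuple s (c - Finsupp.single i 1 : Fin n →₀ ℕ)) else 0) := by
  rw [Lsum_WW_succ, List.toFinset_cons, Finset.sum_insert, toFinset_mkTuple,
    Finset.sum_image (fun x _ y _ h => hs h), Finset.sum_filter]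
  · congr 2
    · simp
    · refine Finset.sum_congr rfl fun i _ => ?_
      rw [List.erase_cons_tail (by simpa using hb i),
        Lsum_congr_perm _ ((mkTuple_erase s hs c i).cons b)]
  · rw [List.mem_toFinset, mem_mkTuple]
    rintro ⟨j, _, h⟩
    exact hb j h

section PS
open MvPowerSeries

variable {k : Type*} [Field k] {n : ℕ}

/-- Linear form. -/
def XX (x : Fin n → k) : MvPowerSeries (Fin n) k := ∑ i, monomial (Finsupp.single i 1) (x i)

/-- Generating series. -/
def ZZ (x : ℕ → Fin n → k) : ℕ → MvPowerSeries (Fin n) k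
  | 0 => 1
  | D + 1 => ZZ x D * (1 - XX (x D))⁻¹

/-- Generating series with one extra letter. -/
def GG (x : ℕ → Fin n → k) (y : ℕ → k) : ℕ → MvPowerSeries (Fin n) k
  | 0 => 0
  | D + 1 => (GG x y D + monomial 0 (y D) * ZZ x (D + 1)) * (1 - XX (x D))⁻¹

theorem XX_inv (x : Fin n → k) : (1 - XX x)⁻¹ * (1 - XX x) = 1 := by
  apply MvPowerSeries.inv_mul_cancel
  rw [← coeff_zero_eq_constantCoeff_apply, XX, map_sub, map_sum, Finset.sum_eq_zero]
  · simp
  · intro i _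
    rw [coeff_monomial, if_neg]
    intro h
    simpa using DFunLike.congr_fun h i

theorem coeff_XX_mul (x : Fin n → k) (f : MvPowerSeries (Fin n) k) (c : Fin n →₀ ℕ) :
    coeff c (XX x * f) = ∑ i, if c i ≠ 0 then x i * coeff (c - Finsupp.single i 1) f else 0 := by
  rw [XX, Finset.sum_mul, map_sum]
  refine Finset.sum_congr rfl fun i _ => ?_
  rw [coeff_monomial_mul]
  congr 1
  rw [Finsupp.single_le_iff, Nat.one_le_iff_ne_zero]

theorem ZZ_succ (x : ℕ → Fin n → k) (D : ℕ) :
    ZZ x (D + 1) = ZZ x D + XX (x D) * ZZ x (D + 1) := by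
  have h := XX_inv (x D)
  have : ZZ x (D + 1) * (1 - XX (x D)) = ZZ x D := by rw [ZZ, mul_assoc, h, mul_one]
  linear_combination this

theorem GG_succ (x : ℕ → Fin n → k) (y : ℕ → k) (D : ℕ) :
    GG x y (D + 1) = GG x y D + (monomial 0 (y D) * ZZ x (D + 1) + XX (x D) * GG x y (D + 1)) := by
  have h := XX_inv (x D)
  have : GG x y (D + 1) * (1 - XX (x D)) = GG x y D + monomial 0 (y D) * ZZ x (D + 1) := by
    rw [GG, mul_assoc, h, mul_one]
  linear_combination this

theorem mkTuple_zero {n : ℕ} (s : Fin n → ℤ) : mkTuple s (0 : Fin n →₀ ℕ) = [] := by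
  rw [List.eq_nil_iff_forall_not_mem]
  intro a
  rw [mem_mkTuple]
  simp

theorem mkTuple_ne {n : ℕ} (s : Fin n → ℤ) (c : Fin n →₀ ℕ) (hc : c ≠ 0) : mkTuple s c ≠ [] := by
  obtain ⟨i, hi⟩ := Finsupp.ne_iff.1 hc
  exact List.ne_nil_of_mem ((mem_mkTuple s c (s i)).2 ⟨i, hi, rfl⟩)

theorem degree_lt (c : Fin n →₀ ℕ) (i : Fin n) (h : c i ≠ 0) :
    (c - Finsupp.single i 1).degree < c.degree := by
  have h1 : Finsupp.single i 1 ≤ c := by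
    rw [Finsupp.single_le_iff]; omega
  have h2 : c - Finsupp.single i 1 + Finsupp.single i 1 = c := tsub_add_cancel_of_le h1
  have h3 := congrArg Finsupp.degree h2
  rw [map_add, Finsupp.degree_single] at h3
  omega

theorem coeff_ZZ (e : ℕ → ℤ → k) (s : Fin n → ℤ) (hs : Function.Injective s) (D : ℕ) :
    ∀ c : Fin n →₀ ℕ, coeff c (ZZ (fun d i => e d (s i)) D) = Lsum (WW e D) (mkTuple s c) := by
  induction D with
  | zero =>
    intro c
    by_cases hc : c = 0
    · subst hc
      rw [mkTuple_zero, Lsum_nil, WW_nil, ZZ]; simp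
    · rw [Lsum_WW_zero _ _ (mkTuple_ne s c hc), ZZ, coeff_one, if_neg hc]
  | succ D ih =>
    intro c
    induction hm : c.degree using Nat.strong_induction_on generalizing c with
    | _ m ih2 =>
      rw [ZZ_succ, zrec e s hs, map_add, ih, coeff_XX_mul]
      congr 1
      refine Finset.sum_congr rfl fun i _ => ?_
      split_ifs with h
      · rw [ih2 _ (hm ▸ degree_lt c i h) _ rfl]
      · rfl

theorem coeff_GG (e : ℕ → ℤ → k) (s : Fin n → ℤ) (hs : Function.Injective s) (b : ℤ)
    (hb : ∀ j, b ≠ s j) (D : ℕ) :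
    ∀ c : Fin n →₀ ℕ, coeff c (GG (fun d i => e d (s i)) (fun d => e d b) D) =
      Lsum (WW e D) (b :: mkTuple s c) := by
  induction D with
  | zero =>
    intro c
    rw [Lsum_WW_zero _ _ (by simp), GG]; simp
  | succ D ih =>
    intro c
    induction hm : c.degree using Nat.strong_induction_on generalizing c with
    | _ m ih2 =>
      rw [GG_succ, grec e s hs b hb, map_add, map_add, ih, coeff_XX_mul]
      congr 2
      · rw [coeff_monomial_mul, if_pos (zero_le), tsub_zero, coeff_ZZ e s hs]
      refine Finset.sum_congr rfl fun i _ => ?_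
      split_ifs with h
      · rw [ih2 _ (hm ▸ degree_lt c i h) _ rfl]
      · rfl

/-- Euler operator. -/
def EE (f : MvPowerSeries (Fin n) k) : MvPowerSeries (Fin n) k :=
  fun m => (m.degree : k) * coeff m f

theorem coeff_EE (f : MvPowerSeries (Fin n) k) (m : Fin n →₀ ℕ) :
    coeff m (EE f) = (m.degree : k) * coeff m f := rfl

theorem EE_mul (f g : MvPowerSeries (Fin n) k) : EE (f * g) = EE f * g + f * EE g := by
  ext m
  simp only [coeff_EE, map_add, coeff_mul, Finset.mul_sum, ← Finset.sum_add_distrib]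
  refine Finset.sum_congr rfl fun p hp => ?_
  rw [← Finset.HasAntidiagonal.mem_antidiagonal.1 hp, map_add]
  push_cast
  ring

theorem EE_add (f g : MvPowerSeries (Fin n) k) : EE (f + g) = EE f + EE g := by
  ext m
  simp only [coeff_EE, map_add, mul_add]

theorem EE_one : EE (1 : MvPowerSeries (Fin n) k) = 0 := by
  ext m
  rw [coeff_EE, coeff_one]
  split_ifs with h
  · subst h; simp
  · simp

theorem EE_XX (x : Fin n → k) : EE (XX x) = XX x := by
  ext m
  rw [coeff_EE, XX, map_sum, Finset.mul_sum]
  refine Finset.sum_congr rfl fun i _ => ?_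
  rw [coeff_monomial]
  split_ifs with h
  · rw [h]; simp
  · simp

theorem XX_sq [CharP k 2] (x : Fin n → k) :
    XX x ^ 2 = ∑ i, monomial (Finsupp.single i 2) 1 * monomial 0 (x i ^ 2) := by
  have : CharP (MvPowerSeries (Fin n) k) 2 :=
    charP_of_injective_ringHom (MvPowerSeries.C_injective (σ := Fin n) (R := k)) 2
  rw [XX, sum_pow_char 2]
  refine Finset.sum_congr rfl fun i _ => ?_
  rw [monomial_pow, monomial_mul_monomial]
  simp

theorem key_series [CharP k 2] (x : ℕ → Fin n → k) (D : ℕ) :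
    EE (ZZ x D) + ∑ i, monomial (Finsupp.single i 2) 1 * GG x (fun d => x d i ^ 2) D
      = (∑ d ∈ Finset.range D, XX (x d)) * ZZ x D := by
  have : CharP (MvPowerSeries (Fin n) k) 2 :=
    charP_of_injective_ringHom (MvPowerSeries.C_injective (σ := Fin n) (R := k)) 2
  induction D with
  | zero => simp [ZZ, GG, EE_one]
  | succ D ih =>
    have h2 : (2 : MvPowerSeries (Fin n) k) = 0 := CharTwo.two_eq_zero
    have hE : EE (ZZ x (D + 1)) = EE (ZZ x D) +
        (XX (x D) * ZZ x (D + 1) + XX (x D) * EE (ZZ x (D + 1))) := by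
      conv_lhs => rw [ZZ_succ]
      rw [EE_add, EE_mul, EE_XX]
    have hG : ∑ i, monomial (Finsupp.single i 2) (1 : k) * GG x (fun d => x d i ^ 2) (D + 1)
        = ∑ i, monomial (Finsupp.single i 2) (1 : k) * GG x (fun d => x d i ^ 2) D
          + (XX (x D) ^ 2 * ZZ x (D + 1) + XX (x D) *
            ∑ i, monomial (Finsupp.single i 2) (1 : k) * GG x (fun d => x d i ^ 2) (D + 1)) := by
      rw [XX_sq, Finset.sum_mul, Finset.mul_sum, ← Finset.sum_add_distrib,
        ← Finset.sum_add_distrib]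
      refine Finset.sum_congr rfl fun i _ => ?_
      conv_lhs => rw [GG_succ]
      ring
    have hZ := ZZ_succ x D
    have hu := XX_inv (x D)
    rw [Finset.sum_range_succ]
    generalize (∑ i, monomial (Finsupp.single i 2) (1 : k) * GG x (fun d => x d i ^ 2) D) = g at *
    generalize (∑ i, monomial (Finsupp.single i 2) (1 : k) * GG x (fun d => x d i ^ 2) (D + 1)) = g'
      at *
    generalize EE (ZZ x (D + 1)) = E' at *
    generalize EE (ZZ x D) = E at *
    generalize (∑ d ∈ Finset.range D, XX (x d)) = S at *
    generalize ZZ x (D + 1) = z' at *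
    generalize ZZ x D = z at *
    generalize (1 - XX (x D))⁻¹ = w at *
    generalize XX (x D) = X at *
    have h3 : (E' + g' - (S + X) * z') * (1 - X) = 0 := by
      linear_combination hE + hG + ih - S * hZ + X ^ 2 * z' * h2
    have h4 : (E' + g' - (S + X) * z') = 0 := by
      linear_combination w * h3 - (E' + g' - (S + X) * z') * hu
    linear_combination h4

end PS

theorem key_identity {R : Type*} [Field R] [CharP R 2] (e : ℕ → ℤ → R)
    (he : ∀ d a, e d (2 * a) = e d a ^ 2) {n : ℕ} (s : Fin n → ℤ)
    (hs : Function.Injective s) (k : Fin n → ℕ) (hk : ∀ i, 1 ≤ k i)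
    (hd2 : ∀ i j, 1 < k i → 2 * s i ≠ s j) (D : ℕ) :
    (∑ i ∈ Finset.univ.filter fun i => 1 < k i,
        Lsum (WW e D) (2 * s i :: mkTuple s (Function.update k i (k i - 2))))
      + (∑ i, k i) • Lsum (WW e D) (mkTuple s k)
      = ∑ i, (∑ d ∈ Finset.range D, e d (s i)) *
          Lsum (WW e D) (mkTuple s (Function.update k i (k i - 1))) := by
  let c : Fin n →₀ ℕ := Finsupp.equivFunOnFinite.symm k
  have hc : ∀ i, c i = k i := fun i => rfl
  have hck : (c : Fin n → ℕ) = k := rfl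
  have hsub : ∀ i m, ((c - Finsupp.single i m : Fin n →₀ ℕ) : Fin n → ℕ)
      = Function.update k i (k i - m) := by
    intro i m
    funext j
    by_cases h : j = i
    · subst h; simp [hc]
    · simp [hc, h, Finsupp.single_apply, Ne.symm h]
  have h := congrArg (MvPowerSeries.coeff c) (key_series (fun d i => e d (s i)) D)
  rw [map_add, coeff_EE, coeff_ZZ e s hs, map_sum, Finset.sum_mul, map_sum, hck] at h
  have hdeg : c.degree = ∑ i, k i := by
    rw [Finsupp.degree_eq_sum]; rfl
  rw [hdeg] at h
  rw [add_comm, nsmul_eq_mul, Finset.sum_filter]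
  convert h using 2
  · refine Finset.sum_congr rfl fun i _ => ?_
    rw [MvPowerSeries.coeff_monomial_mul]
    have hle : Finsupp.single i 2 ≤ c ↔ 1 < k i := by
      rw [Finsupp.single_le_iff, hc]; omega
    by_cases h1 : 1 < k i
    · rw [if_pos h1, if_pos (hle.2 h1), one_mul]
      have := coeff_GG e s hs (2 * s i) (fun j => hd2 i j h1) D (c - Finsupp.single i 2)
      rw [hsub] at this
      rw [← this]
      simp only [he]
    · rw [if_neg h1, if_neg (fun h => h1 (hle.1 h))]
  · simp only [coeff_XX_mul]
    rw [Finset.sum_comm]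
    refine Finset.sum_congr rfl fun i _ => ?_
    rw [Finset.sum_mul]
    refine Finset.sum_congr rfl fun d _ => ?_
    rw [if_pos (by rw [hc]; have := hk i; omega), coeff_ZZ e s hs, hsub]

/-- Finite set of truncated antitone tuples. -/
def TT (r D : ℕ) : Finset (Fin r → ℕ) :=
  (Fintype.piFinset (fun _ : Fin r => Finset.range D)).filter Antitone

theorem mem_TT {r D : ℕ} (d : Fin r → ℕ) : d ∈ TT r D ↔ (∀ i, d i < D) ∧ Antitone d := by
  simp [TT]

theorem antitone_cons {r : ℕ} (a : ℕ) (d : Fin r → ℕ) :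
    Antitone (Fin.cons a d : Fin (r + 1) → ℕ) ↔ (∀ i, d i ≤ a) ∧ Antitone d := by
  constructor
  · intro h
    refine ⟨fun i => ?_, fun i j hij => ?_⟩
    · simpa using h (Fin.zero_le i.succ)
    · simpa using h (Fin.succ_le_succ_iff.2 hij)
  · rintro ⟨h1, h2⟩ i j hij
    induction i using Fin.cases with
    | zero =>
      induction j using Fin.cases with
      | zero => simp
      | succ j => simpa using h1 j
    | succ i =>
      induction j using Fin.cases with
      | zero => simp at hij
      | succ j => simpa using h2 (Fin.succ_le_succ_iff.1 hij)

theorem WW_eq {R : Type*} [CommRing R] (e : ℕ → ℤ → R) (w : List ℤ) :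
    ∀ D, WW e D w = ∑ d ∈ TT w.length D, ∏ i, e (d i) (w.get i) := by
  induction w with
  | nil =>
    intro D
    rw [WW_nil]
    have : TT ([] : List ℤ).length D = {fun i => i.elim0} := by
      ext d
      rw [mem_TT, Finset.mem_singleton]
      refine ⟨fun _ => funext fun i => i.elim0, fun _ => ⟨fun i => i.elim0, fun i => i.elim0⟩⟩
    rw [this, Finset.sum_singleton]
    exact (Finset.prod_of_isEmpty (ι := Fin 0) _).symm
  | cons a w ihw =>
    intro D
    induction D with
    | zero =>
      rw [WW]
      symm
      refine Finset.sum_eq_zero fun d hd => ?_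
      rw [mem_TT] at hd
      exact absurd (hd.1 ⟨0, by simp⟩) (by simp)
    | succ D ihD =>
      rw [WW, ihD, ihw]
      change (∑ d ∈ TT (w.length + 1) D, ∏ i : Fin (w.length + 1), e (d i) ((a :: w).get i)) + _
        = (∑ d ∈ TT (w.length + 1) (D + 1), ∏ i : Fin (w.length + 1), e (d i) ((a :: w).get i))
      rw [← Finset.sum_filter_add_sum_filter_not (TT (w.length + 1) (D + 1)) (fun d => d 0 < D)]
      congr 1
      · refine Finset.sum_congr ?_ fun _ _ => rfl
        ext d
        rw [Finset.mem_filter, mem_TT, mem_TT]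
        constructor
        · rintro ⟨h1, h2⟩
          exact ⟨⟨fun i => (h1 i).trans (Nat.lt_succ_self _), h2⟩, h1 0⟩
        · rintro ⟨⟨_, h2⟩, h3⟩
          exact ⟨fun i => (h2 (Fin.zero_le i)).trans_lt h3, h2⟩
      · rw [Finset.mul_sum]
        refine Finset.sum_nbij' (fun d => (Fin.cons D d : Fin (w.length + 1) → ℕ))
          (fun d => Fin.tail d) ?_ ?_ ?_ ?_ ?_
        · intro d hd
          rw [mem_TT] at hd
          rw [Finset.mem_filter, mem_TT, antitone_cons]
          refine ⟨⟨fun i => ?_, fun i => Nat.lt_succ_iff.1 (hd.1 i), hd.2⟩, by simp⟩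
          induction i using Fin.cases with
          | zero => simp
          | succ i => simpa using hd.1 i
        · intro d hd
          rw [Finset.mem_filter, mem_TT] at hd
          rw [mem_TT]
          exact ⟨fun i => hd.1.1 i.succ, fun i j hij => hd.1.2 (Fin.succ_le_succ_iff.2 hij)⟩
        · intro d _
          exact Fin.tail_cons _ _
        · intro d hd
          rw [Finset.mem_filter, mem_TT] at hd
          have h0 : d 0 = D := by
            have := hd.1.1 0
            have := hd.2
            omega
          rw [← h0]
          exact Fin.cons_self_tail d
        · intro d _
          rw [Fin.prod_univ_succ]
          simp

section Val
variable {F : Type*} [Field F]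

theorem tendsto_zetavStar (v : Polynomial F) (hv : Irreducible v) (w : List ℤ)
    (h : Summable (zetavStarTerm v hv w)) :
    Filter.Tendsto (fun D => algebraMap (RatFunc F) (Kv v hv) (WW (Stilde v) D w)) Filter.atTop
      (nhds (zetavStar v hv w)) := by
  have h1 := h.hasSum
  have h2 : Filter.Tendsto (fun D => (TT w.length D).subtype Antitone)
      Filter.atTop Filter.atTop := by
    rw [Filter.tendsto_atTop]
    intro S
    rw [Filter.eventually_atTop]
    refine ⟨S.sup (fun d => Finset.univ.sup (fun i => d.1 i + 1)), fun D hD d hd => ?_⟩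
    rw [Finset.mem_subtype, mem_TT]
    refine ⟨fun i => ?_, d.2⟩
    have h3 : Finset.univ.sup (fun i => d.1 i + 1) ≤ D :=
      (Finset.le_sup (f := fun d : {d : Fin w.length → ℕ // Antitone d} =>
        Finset.univ.sup (fun i => d.1 i + 1)) hd).trans hD
    have h4 := (Finset.le_sup (f := fun i => d.1 i + 1) (Finset.mem_univ i)).trans h3
    exact h4
  have h3 := Filter.Tendsto.comp h1 h2
  refine h3.congr fun D => ?_
  simp only [Function.comp]
  rw [WW_eq, map_sum]
  have : ∀ d ∈ TT w.length D, Antitone d := fun d hd => ((mem_TT d).1 hd).2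
  rw [← Finset.sum_subtype_of_mem (p := Antitone) _ this]
  rfl

instance instKvTG (v : Polynomial F) (hv : Irreducible v) : IsTopologicalRing (Kv v hv) :=
  inferInstanceAs (IsTopologicalRing ((heightOneOf v hv).adicCompletion (RatFunc F)))

instance instKvT2 (v : Polynomial F) (hv : Irreducible v) : T2Space (Kv v hv) :=
  inferInstanceAs (T2Space ((heightOneOf v hv).adicCompletion (RatFunc F)))

theorem tendsto_Lsum (v : Polynomial F) (hv : Irreducible v) (u : List ℤ)
    (h : ∀ w : List ℤ, w.Perm u → Summable (zetavStarTerm v hv w)) :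
    Filter.Tendsto (fun D => algebraMap (RatFunc F) (Kv v hv) (Lsum (WW (Stilde v) D) u))
      Filter.atTop (nhds (Lsum (zetavStar v hv) u)) := by
  unfold Lsum
  simp only [finsum_mem_eq_finite_toFinset_sum _ (finite_perms u), map_sum]
  refine tendsto_finsetSum _ fun w hw => tendsto_zetavStar v hv w (h w ?_)
  simpa using hw

/-- shorthand for the valuation -/
abbrev nu (v : Polynomial F) (hv : Irreducible v) := (heightOneOf v hv).valuation (RatFunc F)

theorem tendsto_zero_of_val (v : Polynomial F) (hv : Irreducible v) (r : ℕ → RatFunc F)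
    (h : ∀ N : ℕ, 1 ≤ N → ∀ᶠ D in Filter.atTop, nu v hv (r D) ≤ WithZero.exp (-(N : ℤ))) :
    Filter.Tendsto (fun D => algebraMap (RatFunc F) (Kv v hv) (r D)) Filter.atTop (nhds 0) := by
  change Filter.Tendsto (fun D => algebraMap (RatFunc F)
    ((heightOneOf v hv).adicCompletion (RatFunc F)) (r D)) Filter.atTop (nhds 0)
  intro s hs
  rw [Valued.mem_nhds_zero] at hs
  obtain ⟨γ, hγ⟩ := hs
  simp only [Valuation.restrict_lt_iff_lt_embedding] at hγ
  generalize hg : MonoidWithZeroHom.ValueGroup₀.embedding γ.1 = g at hγ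
  have hg0 : g ≠ 0 := by
    rw [← hg]
    simp
  obtain ⟨N, hN1, hN⟩ : ∃ N : ℕ, 1 ≤ N ∧ WithZero.exp (-(N : ℤ)) < g := by
    refine ⟨(1 - WithZero.log g).toNat + 1, by omega, ?_⟩
    rw [← WithZero.exp_log hg0, WithZero.exp_lt_exp, WithZero.log_exp]
    omega
  rw [Filter.mem_map]
  filter_upwards [h N hN1] with D hD
  apply hγ
  refine lt_of_le_of_lt ?_ hN
  exact le_trans (le_of_eq (IsDedekindDomain.HeightOneSpectrum.adicCompletion.valued_coe _ _ _)) hD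

theorem nu_eq_one (v : Polynomial F) (hv : Irreducible v) (a : Polynomial F) (ha : ¬ v ∣ a) :
    nu v hv (algebraMap _ _ a) = 1 := by
  rw [nu, IsDedekindDomain.HeightOneSpectrum.valuation_of_algebraMap,
    IsDedekindDomain.HeightOneSpectrum.intValuation_eq_one_iff]
  change a ∉ Ideal.span {v}
  rwa [Ideal.mem_span_singleton]

theorem nu_le_of_dvd (v : Polynomial F) (hv : Irreducible v) (a : Polynomial F) (N : ℕ)
    (ha : v ^ N ∣ a) :
    nu v hv (algebraMap _ _ a) ≤ WithZero.exp (-(N : ℤ)) := by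
  rw [nu, IsDedekindDomain.HeightOneSpectrum.valuation_of_algebraMap,
    IsDedekindDomain.HeightOneSpectrum.intValuation_le_pow_iff_mem]
  change a ∈ Ideal.span {v} ^ N
  rwa [Ideal.span_singleton_pow, Ideal.mem_span_singleton]

theorem nu_zpow_sub (v : Polynomial F) (hv : Irreducible v) (a b : Polynomial F) (N : ℕ)
    (ha : ¬ v ∣ a) (hb : ¬ v ∣ b) (hab : v ^ N ∣ a - b) (z : ℤ) :
    nu v hv ((algebraMap _ (RatFunc F) a) ^ z - (algebraMap _ (RatFunc F) b) ^ z)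
      ≤ WithZero.exp (-(N : ℤ)) := by
  have hpos : ∀ m : ℕ, nu v hv ((algebraMap _ (RatFunc F) a) ^ m - (algebraMap _ (RatFunc F) b) ^ m)
      ≤ WithZero.exp (-(N : ℤ)) := by
    intro m
    rw [← map_pow, ← map_pow, ← map_sub]
    exact nu_le_of_dvd v hv _ N (hab.trans (sub_dvd_pow_sub_pow a b m))
  have ha0 : algebraMap _ (RatFunc F) a ≠ 0 := by
    intro h
    have := nu_eq_one v hv a ha
    rw [h] at this
    simp at this
  have hb0 : algebraMap _ (RatFunc F) b ≠ 0 := by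
    intro h
    have := nu_eq_one v hv b hb
    rw [h] at this
    simp at this
  obtain ⟨m, rfl | rfl⟩ := z.eq_nat_or_neg
  · simpa using hpos m
  · have : (algebraMap _ (RatFunc F) a) ^ (-(m : ℤ)) - (algebraMap _ (RatFunc F) b) ^ (-(m : ℤ))
        = -((algebraMap _ (RatFunc F) a) ^ m - (algebraMap _ (RatFunc F) b) ^ m) *
          (((algebraMap _ (RatFunc F) a) ^ m)⁻¹ * ((algebraMap _ (RatFunc F) b) ^ m)⁻¹) := by
      simp only [zpow_neg, zpow_natCast]
      field_simp
      ring
    rw [this, map_mul, map_mul, map_inv₀, map_inv₀, map_pow, map_pow, nu_eq_one v hv a ha,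
      nu_eq_one v hv b hb, Valuation.map_neg]
    simpa using hpos m

variable [Fintype F]

theorem finite_degLT_s6 (D : ℕ) : {a : Polynomial F | a.degree < (D : WithBot ℕ)}.Finite := by
  have : Finite (Polynomial.degreeLT F D) :=
    Finite.of_equiv _ (Polynomial.degreeLTEquiv F D).toEquiv.symm
  refine Set.Finite.subset (Set.toFinite (Polynomial.degreeLT F D : Set (Polynomial F))) ?_
  intro a ha
  exact Polynomial.mem_degreeLT.2 ha

theorem finite_monics (v : Polynomial F) (d : ℕ) :
    {a : Polynomial F | a.Monic ∧ a.natDegree = d ∧ ¬ v ∣ a}.Finite := by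
  refine (finite_degLT_s6 (d + 1)).subset ?_
  rintro a ⟨h1, h2, _⟩
  change a.degree < _
  rw [Polynomial.degree_eq_natDegree h1.ne_zero, h2]
  exact_mod_cast Nat.lt_succ_self d

theorem Stilde_eq (v : Polynomial F) (d : ℕ) (k : ℤ) : Stilde v d k =
    ∑ a ∈ (finite_monics v d).toFinset, (algebraMap (Polynomial F) (RatFunc F) a) ^ (-k) := by
  rw [Stilde, finsum_mem_eq_finite_toFinset_sum]

theorem Stilde_double [CharP (RatFunc F) 2] (v : Polynomial F) (d : ℕ) (k : ℤ) :
    Stilde v d (2 * k) = Stilde v d k ^ 2 := by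
  rw [Stilde_eq, Stilde_eq, sum_pow_char 2]
  refine Finset.sum_congr rfl fun a _ => ?_
  rw [← zpow_natCast, ← zpow_mul]
  congr 1
  push_cast
  ring

theorem nu_Stilde (v : Polynomial F) (hv : Irreducible v) (d : ℕ) (k : ℤ) :
    nu v hv (Stilde v d k) ≤ 1 := by
  rw [Stilde_eq]
  refine Valuation.map_sum_le _ fun a ha => ?_
  have ha : a.Monic ∧ a.natDegree = d ∧ ¬ v ∣ a := by simpa using ha
  rw [map_zpow₀, nu_eq_one v hv a ha.2.2, one_zpow]

theorem nu_WW (v : Polynomial F) (hv : Irreducible v) (D : ℕ) (w : List ℤ) :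
    nu v hv (WW (Stilde v) D w) ≤ 1 := by
  rw [WW_eq]
  refine Valuation.map_sum_le _ fun d _ => ?_
  rw [map_prod]
  exact Finset.prod_le_one' fun i _ => nu_Stilde v hv _ _

theorem nu_Lsum (v : Polynomial F) (hv : Irreducible v) (D : ℕ) (u : List ℤ) :
    nu v hv (Lsum (WW (Stilde v) D) u) ≤ 1 := by
  rw [Lsum, finsum_mem_eq_finite_toFinset_sum _ (finite_perms u)]
  exact Valuation.map_sum_le _ fun d _ => nu_WW v hv D d

theorem full_sum (v : Polynomial F) (hv : Irreducible v) [CharP (RatFunc F) 2] [CharP F 2]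
    (k : ℤ) (hk : ((Fintype.card F : ℤ) - 1) ∣ k) (D : ℕ) :
    ∑ d ∈ Finset.range D, Stilde v d k =
      ∑ a ∈ (finite_degLT_s6 (F := F) D).toFinset.filter (fun a => ¬ v ∣ a),
        (algebraMap (Polynomial F) (RatFunc F) a) ^ (-k) := by
  have hcard : ((Fintype.card Fˣ : ℕ) : RatFunc F) = 1 := by
    have h2 : (Fintype.card F : RatFunc F) = 0 := by
      have : (Fintype.card F : F) = 0 := FiniteField.cast_card_eq_zero F
      have h3 := congrArg (algebraMap F (RatFunc F)) this
      rwa [map_natCast, map_zero] at h3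
    rw [Fintype.card_units, Nat.cast_sub Fintype.card_pos, h2, zero_sub, Nat.cast_one,
      CharTwo.neg_eq]
  have h1 : ∀ d, Stilde v d k = ∑ c : Fˣ, ∑ a ∈ (finite_monics v d).toFinset,
      (algebraMap (Polynomial F) (RatFunc F) (Polynomial.C (c : F) * a)) ^ (-k) := by
    intro d
    have : ∀ c : Fˣ, ∑ a ∈ (finite_monics v d).toFinset,
      (algebraMap (Polynomial F) (RatFunc F) (Polynomial.C (c : F) * a)) ^ (-k) = Stilde v d k := by
      intro c
      rw [Stilde_eq]
      refine Finset.sum_congr rfl fun a _ => ?_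
      have hc : (c : F) ^ (-k) = 1 := by
        obtain ⟨m, rfl⟩ := hk
        rw [← mul_neg, zpow_mul]
        have h2 : ((Fintype.card F : ℤ) - 1) = ((Fintype.card F - 1 : ℕ) : ℤ) := by
          rw [Nat.cast_sub Fintype.card_pos]; simp
        rw [h2, zpow_natCast, FiniteField.pow_card_sub_one_eq_one _ c.ne_zero, one_zpow]
      rw [map_mul, mul_zpow]
      have h3 : (algebraMap (Polynomial F) (RatFunc F) (Polynomial.C (c : F))) ^ (-k) = 1 := by
        rw [RatFunc.algebraMap_C, ← map_zpow₀, hc, map_one]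
      rw [h3, one_mul]
    simp only [this]
    rw [Finset.sum_const, Finset.card_univ, nsmul_eq_mul, hcard, one_mul]
  simp only [h1, Finset.sum_sigma']
  refine Finset.sum_bij' (fun x _ => Polynomial.C (x.2.1 : F) * x.2.2) (fun a _ =>
    ⟨a.natDegree, if h : a.leadingCoeff ≠ 0 then Units.mk0 a.leadingCoeff h else 1,
      Polynomial.C (a.leadingCoeff)⁻¹ * a⟩) ?_ ?_ ?_ ?_ ?_
  · rintro ⟨d, c, a⟩ h
    have h : d < D ∧ a.Monic ∧ a.natDegree = d ∧ ¬ v ∣ a := by simpa using h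
    obtain ⟨h0, h1, h2, h3⟩ := h
    have : (Polynomial.C (c : F) * a).degree < D ∧ ¬ v ∣ Polynomial.C (c : F) * a := by
      constructor
      · rw [Polynomial.degree_C_mul c.ne_zero, Polynomial.degree_eq_natDegree h1.ne_zero, h2]
        exact_mod_cast h0
      · rwa [(Polynomial.isUnit_C.2 c.isUnit).dvd_mul_left]
    simpa using this
  · intro a h
    have h : a.degree < D ∧ ¬ v ∣ a := by simpa using h
    have ha : a ≠ 0 := by rintro rfl; exact h.2 (dvd_zero v)
    have hl : a.leadingCoeff ≠ 0 := Polynomial.leadingCoeff_ne_zero.2 ha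
    have h1 : a.natDegree < D := by
      have := h.1
      rw [Polynomial.degree_eq_natDegree ha] at this
      exact_mod_cast this
    have h2 : (Polynomial.C (a.leadingCoeff)⁻¹ * a).Monic := by
      rw [Polynomial.Monic, Polynomial.leadingCoeff_mul, Polynomial.leadingCoeff_C,
        inv_mul_cancel₀ hl]
    have h3 : (Polynomial.C (a.leadingCoeff)⁻¹ * a).natDegree = a.natDegree :=
      Polynomial.natDegree_C_mul (inv_ne_zero hl)
    have h4 : ¬ v ∣ Polynomial.C (a.leadingCoeff)⁻¹ * a := by
      rw [(Polynomial.isUnit_C.2 (inv_ne_zero hl).isUnit).dvd_mul_left]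
      exact h.2
    rw [Finset.mem_sigma, Finset.mem_sigma, Set.Finite.mem_toFinset]
    exact ⟨Finset.mem_range.2 h1, Finset.mem_univ _, h2, h3, h4⟩
  · rintro ⟨d, c, a⟩ h
    have h : d < D ∧ a.Monic ∧ a.natDegree = d ∧ ¬ v ∣ a := by simpa using h
    obtain ⟨h0, h1, h2, h3⟩ := h
    subst h2
    have h4 : (Polynomial.C (c : F) * a).leadingCoeff = c := by
      rw [Polynomial.leadingCoeff_mul, Polynomial.leadingCoeff_C, h1.leadingCoeff, mul_one]
    have h5 : (Polynomial.C (c : F) * a).natDegree = a.natDegree :=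
      Polynomial.natDegree_C_mul c.ne_zero
    have h6 : Polynomial.C ((c : F)⁻¹) * (Polynomial.C (c : F) * a) = a := by
      rw [← mul_assoc, ← Polynomial.C_mul, inv_mul_cancel₀ c.ne_zero, Polynomial.C_1, one_mul]
    simp only [h4, h5, h6]
    simp
  · intro a h
    have h : a.degree < D ∧ ¬ v ∣ a := by simpa using h
    have ha : a ≠ 0 := by rintro rfl; exact h.2 (dvd_zero v)
    have hl : a.leadingCoeff ≠ 0 := Polynomial.leadingCoeff_ne_zero.2 ha
    simp only [dif_pos hl, Units.val_mk0]
    rw [← mul_assoc, ← Polynomial.C_mul, mul_inv_cancel₀ hl, Polynomial.C_1, one_mul]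
  · intro x _
    rfl

theorem nu_full (v : Polynomial F) (hv : Irreducible v) [CharP (RatFunc F) 2] [CharP F 2]
    (k : ℤ) (N D : ℕ) (hN : 1 ≤ N) (hD : (v ^ N).natDegree < D) :
    nu v hv (∑ a ∈ (finite_degLT_s6 (F := F) D).toFinset.filter (fun a => ¬ v ∣ a),
        (algebraMap (Polynomial F) (RatFunc F) a) ^ (-k)) ≤ WithZero.exp (-(N : ℤ)) := by
  let I : AddSubgroup (RatFunc F) :=
    { carrier := {x | nu v hv x ≤ WithZero.exp (-(N : ℤ))}
      zero_mem' := by simp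
      add_mem' := fun {a b} ha hb => by
        exact Valuation.map_add_le (nu v hv) ha hb
      neg_mem' := fun {a} ha => by
        simpa [Valuation.map_neg] using ha }
  change _ ∈ I
  rw [← QuotientAddGroup.eq_zero_iff]
  rw [← QuotientAddGroup.mk'_apply, map_sum]
  have hv0 : v ^ N ≠ 0 := pow_ne_zero _ hv.ne_zero
  have hvv : v ∣ v ^ N := dvd_pow_self v (by omega)
  have hchar : ∀ x : RatFunc F, -x = x := fun x => CharTwo.neg_eq x
  have hcharP : CharP (Polynomial F) 2 := inferInstance
  refine Finset.sum_involution (fun a _ => a + v ^ N) ?_ ?_ ?_ ?_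
  · intro a ha
    have ha : a.degree < D ∧ ¬ v ∣ a := by simpa using ha
    rw [← map_add, QuotientAddGroup.mk'_apply, QuotientAddGroup.eq_zero_iff]
    have := nu_zpow_sub v hv a (a + v ^ N) N ha.2
      (fun h => ha.2 ((dvd_add_left hvv).1 h)) (by simp) (-k)
    rwa [sub_eq_add_neg, hchar] at this
  · intro a _ _ h
    exact hv0 (by simpa using h)
  · intro a ha
    have ha : a.degree < D ∧ ¬ v ∣ a := by simpa using ha
    have : (a + v ^ N).degree < D ∧ ¬ v ∣ (a + v ^ N) := by
      refine ⟨?_, fun h => ha.2 ((dvd_add_left hvv).1 h)⟩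
      refine (Polynomial.degree_add_le _ _).trans_lt (max_lt ha.1 ?_)
      rw [Polynomial.degree_eq_natDegree hv0]
      exact_mod_cast hD
    simpa using this
  · intro a _
    rw [add_assoc, CharTwo.add_self_eq_zero, add_zero]

end Val

theorem statement6 {F : Type*} [Field F] [Fintype F] (q : ℕ) (hq : Fintype.card F = q)
    (hq2 : ∃ m : ℕ, q = 2 ^ m)
    (v : Polynomial F) (hvmonic : v.Monic) (hv : Irreducible v)
    (n : ℕ) (hn : 1 ≤ n) (s : Fin n → ℤ) (k : Fin n → ℕ) (hk : ∀ i, 1 ≤ k i)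
    (hinj : Function.Injective s)
    (hd2 : ∀ i j, 1 < k i → 2 * s i ≠ s j)
    (hd3 : ∀ i j, 1 < k i → 1 < k j → i ≠ j → 2 * s i ≠ 2 * s j)
    (heven : ∀ i, ((q : ℤ) - 1) ∣ s i)
    (hsum : ∀ w : List ℤ,
      (List.Perm w (mkTuple s k) ∨
        ∃ i, 1 < k i ∧
          List.Perm w (2 * s i :: mkTuple s (Function.update k i (k i - 2)))) →
      Summable (zetavStarTerm v hv w)) :
    (∑ i ∈ Finset.univ.filter fun i => 1 < k i,
        Lsum (zetavStar v hv) (2 * s i :: mkTuple s (Function.update k i (k i - 2))))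
      + (∑ i, k i) • Lsum (zetavStar v hv) (mkTuple s k) = 0 := by
  have h2F : (2 : F) = 0 := by
    obtain ⟨m, hm⟩ := hq2
    have h := FiniteField.cast_card_eq_zero F
    rw [hq, hm] at h
    push_cast at h
    by_contra h0
    exact pow_ne_zero m h0 h
  have hF : CharP F 2 := CharTwo.of_one_ne_zero_of_two_eq_zero one_ne_zero h2F
  have hR : CharP (RatFunc F) 2 :=
    charP_of_injective_algebraMap (algebraMap F (RatFunc F)).injective 2
  subst hq
  have hid := key_identity (Stilde v) (fun d a => Stilde_double v d a) s hinj k hk hd2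
  have hL : Filter.Tendsto (fun D => algebraMap (RatFunc F) (Kv v hv)
      ((∑ i ∈ Finset.univ.filter fun i => 1 < k i,
        Lsum (WW (Stilde v) D) (2 * s i :: mkTuple s (Function.update k i (k i - 2))))
      + (∑ i, k i) • Lsum (WW (Stilde v) D) (mkTuple s k))) Filter.atTop
      (nhds ((∑ i ∈ Finset.univ.filter fun i => 1 < k i,
        Lsum (zetavStar v hv) (2 * s i :: mkTuple s (Function.update k i (k i - 2))))
      + (∑ i, k i) • Lsum (zetavStar v hv) (mkTuple s k))) := by
    simp only [map_add, map_sum, map_nsmul]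
    refine Filter.Tendsto.add (tendsto_finsetSum _ fun i hi => ?_) ?_
    · refine tendsto_Lsum v hv _ fun w hw => hsum w (Or.inr ⟨i, ?_, hw⟩)
      simpa using hi
    · exact (tendsto_Lsum v hv _ fun w hw => hsum w (Or.inl hw)).const_smul _
  refine tendsto_nhds_unique hL ?_
  simp only [hid]
  refine tendsto_zero_of_val v hv _ fun N hN => ?_
  filter_upwards [Filter.eventually_gt_atTop (v ^ N).natDegree] with D hD
  refine Valuation.map_sum_le _ fun i _ => ?_
  rw [map_mul]
  refine (mul_le_mul' ?_ (nu_Lsum v hv D _)).trans (mul_one _).le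
  rw [full_sum v hv (s i) (heven i)]
  exact nu_full v hv (s i) N D hN hD

end
end
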